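/- arXiv:2205.15239 — 3 statements merged into one kernel-verified Lean document; each statement's English description precedes it below -/
import Mathlib

section
/- Let 𝒴 = {y_1, …, y_K} be a finite set of K ≥ 1 classes indexed so that π(y_1) ≤ π(y_2) ≤ … ≤ π(y_K), and write π_i = π(y_i). Then for every p ∈ ℙ(𝒴): p belongs to the credal set Q_π if and only if ∑_{k=1}^{i} p(y_k) ≤ π_i for every i ∈ {1, …, K}. -/
/-- `p` is a probability distribution on `Fin K`, i.e. an element of the simplex `ℙ(𝒴)`. -/
def IsDist {K : ℕ} (p : Fin K → ℝ) : Prop :=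
  (∀ i, 0 ≤ p i) ∧ (∀ i, p i ≤ 1) ∧ ∑ i, p i = 1

/-- `p` satisfies the credal-set constraints induced by the possibility distribution `π`:
for every subset `A` of classes, `∑_{y∈A} p(y) ≤ max_{y∈A} π(y)` (the condition for the
empty set, `0 ≤ 0`, holds trivially). -/
def CredalConstraints {K : ℕ} (π p : Fin K → ℝ) : Prop :=
  ∀ A : Finset (Fin K), ∀ h : A.Nonempty, ∑ y ∈ A, p y ≤ A.sup' h π

/-- For classes indexed so that `π` is monotone (i.e.
`π(y_1) ≤ … ≤ π(y_K)`), a probability distribution `p` belongs to the credal set `Q_π`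
if and only if `∑_{k=1}^i p(y_k) ≤ π_i` for every index `i`. -/
theorem credal_iff_partial_sums {K : ℕ} (hK : 1 ≤ K)
    (π : Fin K → ℝ) (hπ0 : ∀ i, 0 ≤ π i) (hπ1 : ∀ i, π i ≤ 1)
    (hmono : Monotone π)
    (p : Fin K → ℝ) (hp : IsDist p) :
    CredalConstraints π p ↔ ∀ i : Fin K, ∑ k ∈ Finset.Iic i, p k ≤ π i := by
  constructor
  · intro h i
    refine (h (Finset.Iic i) Finset.nonempty_Iic).trans (Finset.sup'_le _ _ fun k hk ↦ ?_)
    exact hmono (Finset.mem_Iic.mp hk)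
  · intro h A hA
    calc ∑ y ∈ A, p y ≤ ∑ k ∈ Finset.Iic (A.max' hA), p k :=
          Finset.sum_le_sum_of_subset_of_nonneg
            (fun y hy ↦ Finset.mem_Iic.mpr (A.le_max' y hy)) fun k _ _ ↦ hp.1 k
      _ ≤ π (A.max' hA) := h _
      _ ≤ A.sup' hA π := Finset.le_sup' π (A.max'_mem hA)
end

section
/- (Conformal rank bound.) Let (Ω, 𝓕, P) be a probability space and let α_1, …, α_{L+1} be real-valued random variables that are exchangeable, i.e., for every permutation σ of {1, …, L+1} the joint distribution of (α_{σ(1)}, …, α_{σ(L+1)}) equals the joint distribution of (α_1, …, α_{L+1}). Define the rank R = #{ i ∈ {1, …, L+1} : α_i ≥ α_{L+1} }. Then for every k ∈ {0, 1, …, L+1}: P(R ≤ k) ≤ k/(L+1). -/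
open MeasureTheory
open scoped Classical ENNReal

/-- At most `k` entries of a finite family have at most `k` entries above or equal to them. -/
theorem card_filter_rank_le {ι β : Type*} [Fintype ι] [LinearOrder β] (v : ι → β) (k : ℕ) :
    (Finset.univ.filter fun j => (Finset.univ.filter fun i => v j ≤ v i).card ≤ k).card ≤ k := by
  set S := Finset.univ.filter fun j => (Finset.univ.filter fun i => v j ≤ v i).card ≤ k with hS
  rcases S.eq_empty_or_nonempty with h | h
  · simp [h]
  · obtain ⟨j, hj, hmin⟩ := S.exists_min_image v h
    exact (Finset.card_le_card fun i hi => by simpa using hmin i hi).trans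
      (Finset.mem_filter.mp hj).2

theorem measurableSet_rank_le {ι : Type*} [Fintype ι] (j : ι) (k : ℕ) :
    MeasurableSet {v : ι → ℝ | (Finset.univ.filter fun i => v j ≤ v i).card ≤ k} := by
  simp only [Finset.card_filter]
  refine measurableSet_le (Finset.measurable_sum _ fun i _ => ?_) measurable_const
  exact Measurable.ite (measurableSet_le (measurable_pi_apply j) (measurable_pi_apply i))
    measurable_const measurable_const

/-- If every point lies in at most `k` of the sets `A i`, their measures sum to at most `k` times
the total mass. -/
theorem sum_measure_le_of_card_le {Ω ι : Type*} [MeasurableSpace Ω] [Fintype ι] (P : Measure Ω)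
    (A : ι → Set Ω) (hA : ∀ i, MeasurableSet (A i)) (k : ℕ)
    (h : ∀ ω, (Finset.univ.filter fun i => ω ∈ A i).card ≤ k) :
    ∑ i, P (A i) ≤ k * P Set.univ := by
  calc ∑ i, P (A i) = ∫⁻ ω, ∑ i, (A i).indicator 1 ω ∂P := by
        rw [lintegral_finsetSum _ fun i _ => measurable_one.indicator (hA i)]
        exact Finset.sum_congr rfl fun i _ => (lintegral_indicator_one (hA i)).symm
    _ ≤ ∫⁻ _, (k : ℝ≥0∞) ∂P := by
        refine lintegral_mono fun ω => ?_
        simp only [Set.indicator_apply, Pi.one_apply, Finset.sum_boole]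
        exact_mod_cast h ω
    _ = k * P Set.univ := lintegral_const _

/-- **Conformal rank bound.**  Let `α_1, …, α_{L+1}` be exchangeable
real-valued random variables (the joint law is invariant under every permutation of the
indices).  With the rank `R(ω) = #{ i : α_i(ω) ≥ α_{L+1}(ω) }`, for every
`k ∈ {0, …, L+1}` one has `P(R ≤ k) ≤ k/(L+1)`.  Here `α_{L+1}` is the last
coordinate `α (Fin.last L)`. -/
theorem conformal_rank_bound {Ω : Type*} [MeasurableSpace Ω]
    (P : Measure Ω) [IsProbabilityMeasure P]
    (L : ℕ) (hL : 1 ≤ L)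
    (α : Fin (L + 1) → Ω → ℝ) (hmeas : ∀ i, Measurable (α i))
    (hexch : ∀ σ : Equiv.Perm (Fin (L + 1)),
      Measure.map (fun ω => fun i => α (σ i) ω) P =
        Measure.map (fun ω => fun i => α i ω) P)
    (k : ℕ) (hk : k ≤ L + 1) :
    P {ω | (Finset.univ.filter fun i : Fin (L + 1) =>
        α (Fin.last L) ω ≤ α i ω).card ≤ k} ≤ (k : ℝ≥0∞) / (L + 1) := by
  have hα : Measurable fun ω i => α i ω := measurable_pi_lambda _ hmeas
  let A : Fin (L + 1) → Set Ω := fun j =>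
    {ω | (Finset.univ.filter fun i => α j ω ≤ α i ω).card ≤ k}
  have hA : ∀ j, MeasurableSet (A j) := fun j => hα (measurableSet_rank_le j k)
  have hA_eq : ∀ j, P (A j) = P (A (Fin.last L)) := by
    intro j
    let σ := Equiv.swap j (Fin.last L)
    have hσ : Measurable fun ω i => α (σ i) ω := measurable_pi_lambda _ fun i => hmeas (σ i)
    have hE := measurableSet_rank_le (Fin.last L) k
    have key := congrArg (fun μ => μ {v : Fin (L + 1) → ℝ |
      (Finset.univ.filter fun i => v (Fin.last L) ≤ v i).card ≤ k}) (hexch σ)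
    simp only [Measure.map_apply hσ hE, Measure.map_apply hα hE] at key
    refine Eq.trans (congrArg P ?_) key
    ext ω
    have hcard : (Finset.univ.filter fun i => α j ω ≤ α (σ i) ω).card =
        (Finset.univ.filter fun i => α j ω ≤ α i ω).card := by
      simp only [Finset.card_filter]
      exact Equiv.sum_comp σ fun i => if α j ω ≤ α i ω then 1 else 0
    simp only [A, Set.mem_preimage, Set.mem_ofPred_eq, σ, Equiv.swap_apply_right] at hcard ⊢
    rw [hcard]
  have hsum := sum_measure_le_of_card_le P A hA k fun ω => by
    simpa only [A, Set.mem_ofPred_eq] using card_filter_rank_le (fun i => α i ω) k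
  simp only [hA_eq, Finset.sum_const, Finset.card_univ, Fintype.card_fin, nsmul_eq_mul,
    measure_univ, mul_one, Nat.cast_add, Nat.cast_one] at hsum
  change P (A (Fin.last L)) ≤ _
  rw [ENNReal.le_div_iff_mul_le (by simp) (by simp), mul_comm]
  exact hsum
end

section
/- (Weak validity of the inductive conformal predictor.) Let α_1, …, α_{L+1} be exchangeable real-valued random variables on a probability space (Ω, 𝓕, P), where α_1, …, α_L are the calibration non-conformity scores and α_{L+1} is the non-conformity score of the test example with its true label y_{N+1}. Define the p-value π(y_{N+1}) = #{ i ∈ {1, …, L} : α_i ≥ α_{L+1} } / (L+1). Then for every δ ∈ (0,1) such that δ·(L+1) is an integer, P( π(y_{N+1}) ≥ δ ) ≥ 1 − δ; equivalently, the conformal prediction set Γ_δ = { ŷ : π(ŷ) ≥ δ } covers the true label with probability at least 1 − δ. -/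
open MeasureTheory
open scoped Classical ENNReal

/-- At most `m` indices `j` have at most `m` entries of `x` weakly above `x j`. -/
theorem card_filter_card_le_le {ι : Type*} [Fintype ι] (x : ι → ℝ) (m : ℕ) :
    (Finset.univ.filter fun j => (Finset.univ.filter fun i => x j ≤ x i).card ≤ m).card ≤ m := by
  set B := Finset.univ.filter fun j => (Finset.univ.filter fun i => x j ≤ x i).card ≤ m
  rcases B.eq_empty_or_nonempty with h | h
  · simp [h]
  · obtain ⟨j, hj, hmin⟩ := B.exists_min_image x h
    refine (Finset.card_le_card fun i hi => ?_).trans (Finset.mem_filter.1 hj).2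
    simpa using hmin i hi

theorem measurableSet_card_filter_le {ι : Type*} [Fintype ι] (j : ι) (m : ℕ) :
    MeasurableSet {x : ι → ℝ | (Finset.univ.filter fun i => x j ≤ x i).card ≤ m} := by
  have h : Measurable fun x : ι → ℝ => (Finset.univ.filter fun i => x j ≤ x i).card := by
    simp only [Finset.card_filter]
    exact Finset.measurable_sum _ fun i _ => Measurable.ite
      (measurableSet_le (measurable_pi_apply j) (measurable_pi_apply i))
      measurable_const measurable_const
  exact h measurableSet_Iic

/-- If every point lies in at most `m` of the sets `A j`, their measures sum to at most `m`. -/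
theorem sum_measure_le_of_card_filter_le {ι Ω : Type*} [Fintype ι] [MeasurableSpace Ω]
    (P : Measure Ω) [IsProbabilityMeasure P] {A : ι → Set Ω} (hA : ∀ j, MeasurableSet (A j))
    (m : ℕ) (h : ∀ ω, (Finset.univ.filter fun j => ω ∈ A j).card ≤ m) :
    ∑ j, P (A j) ≤ m := by
  calc ∑ j, P (A j) = ∫⁻ ω, ∑ j, (A j).indicator 1 ω ∂P := by
        rw [lintegral_finsetSum _ fun j _ => measurable_one.indicator (hA j)]
        simp [hA]
    _ ≤ ∫⁻ _, (m : ℝ≥0∞) ∂P := by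
        refine lintegral_mono fun ω => ?_
        simp only [Set.indicator_apply, Pi.one_apply, Finset.sum_boole]
        exact_mod_cast h ω
    _ = m := by simp

/-- For exchangeable scores, the probability that at most `m` of them are weakly above the score
with index `k` is at most `m / card ι`. -/
theorem card_mul_measure_card_filter_le_le {ι Ω : Type*} [Fintype ι] [MeasurableSpace Ω]
    (P : Measure Ω) [IsProbabilityMeasure P] (α : ι → Ω → ℝ) (hmeas : ∀ i, Measurable (α i))
    (hexch : ∀ σ : Equiv.Perm ι,
      Measure.map (fun ω => fun i => α (σ i) ω) P = Measure.map (fun ω => fun i => α i ω) P)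
    (k : ι) (m : ℕ) :
    (Fintype.card ι : ℝ≥0∞) *
      P {ω | (Finset.univ.filter fun i => α k ω ≤ α i ω).card ≤ m} ≤ m := by
  let A : ι → Set Ω := fun j => {ω | (Finset.univ.filter fun i => α j ω ≤ α i ω).card ≤ m}
  have hA : ∀ j, MeasurableSet (A j) := fun j =>
    measurable_pi_lambda (fun ω i => α i ω) hmeas (measurableSet_card_filter_le j m)
  have heq : ∀ j, P (A j) = P (A k) := by
    intro j
    have h := congrArg (fun μ => μ {x : ι → ℝ | (Finset.univ.filter fun i => x k ≤ x i).card ≤ m})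
      (hexch (Equiv.swap k j))
    rw [Measure.map_apply (measurable_pi_lambda _ fun i => hmeas _)
        (measurableSet_card_filter_le k m),
      Measure.map_apply (measurable_pi_lambda _ hmeas) (measurableSet_card_filter_le k m)] at h
    refine Eq.trans (congrArg P ?_) h
    ext ω
    simp only [A, Set.mem_ofPred_eq, Set.mem_preimage, Equiv.swap_apply_left]
    rw [Finset.card_equiv (Equiv.swap k j) fun i => ?_]
    simp
  have h := sum_measure_le_of_card_filter_le P hA m
    fun ω => by
      convert card_filter_card_le_le (fun i => α i ω) m using 2
      ext j
      simp [A]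
  simpa [heq] using h

/-- **Weak validity of the inductive conformal predictor.**  Let
`α_1, …, α_{L+1}` be exchangeable real-valued random variables, where
`α_1, …, α_L` (the coordinates `α i.castSucc`, `i : Fin L`) are the calibration
non-conformity scores and `α_{L+1} = α (Fin.last L)` is the score of the test example
with its true label.  With the conformal p-value
`π(y_{N+1})(ω) = #{ i ∈ {1,…,L} : α_i(ω) ≥ α_{L+1}(ω) } / (L+1)`, for every
`δ ∈ (0,1)` such that `δ·(L+1)` is an integer, `P(π(y_{N+1}) ≥ δ) ≥ 1 − δ`;
i.e. the conformal prediction set `Γ_δ = { ŷ : π(ŷ) ≥ δ }` covers the true label with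
probability at least `1 − δ`. -/
theorem conformal_weak_validity {Ω : Type*} [MeasurableSpace Ω]
    (P : Measure Ω) [IsProbabilityMeasure P]
    (L : ℕ) (hL : 1 ≤ L)
    (α : Fin (L + 1) → Ω → ℝ) (hmeas : ∀ i, Measurable (α i))
    (hexch : ∀ σ : Equiv.Perm (Fin (L + 1)),
      Measure.map (fun ω => fun i => α (σ i) ω) P =
        Measure.map (fun ω => fun i => α i ω) P)
    (δ : ℝ) (hδ0 : 0 < δ) (hδ1 : δ < 1)
    (hint : ∃ m : ℕ, δ * (L + 1) = m) :
    ENNReal.ofReal (1 - δ) ≤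
      P {ω | δ ≤ ((Finset.univ.filter fun i : Fin L =>
        α (Fin.last L) ω ≤ α i.castSucc ω).card : ℝ) / (L + 1)} := by
  obtain ⟨m, hm⟩ := hint
  have hL0 : (0 : ℝ) < L + 1 := by positivity
  have hbad := card_mul_measure_card_filter_le_le P α hmeas hexch (Fin.last L) m
  set B : Set Ω := {ω | (Finset.univ.filter fun i => α (Fin.last L) ω ≤ α i ω).card ≤ m} with hB
  have hBm : MeasurableSet B :=
    measurable_pi_lambda (fun ω i => α i ω) hmeas (measurableSet_card_filter_le (Fin.last L) m)
  have hgood : {ω | δ ≤ ((Finset.univ.filter fun i : Fin L =>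
      α (Fin.last L) ω ≤ α i.castSucc ω).card : ℝ) / (L + 1)} = Bᶜ := by
    ext ω
    have hcard : (Finset.univ.filter fun i => α (Fin.last L) ω ≤ α i ω).card =
        (Finset.univ.filter fun i : Fin L => α (Fin.last L) ω ≤ α i.castSucc ω).card + 1 := by
      simp only [Finset.card_filter, Fin.sum_univ_castSucc, le_refl, if_true]
    simp only [hB, Set.mem_ofPred_eq, Set.mem_compl_iff, hcard, le_div_iff₀ hL0, hm, Nat.cast_le]
    omega
  have hPB : P B ≤ ENNReal.ofReal δ := by
    rw [← ENNReal.ofReal_toReal (measure_ne_top P B)]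
    refine ENNReal.ofReal_le_ofReal (le_of_mul_le_mul_left ?_ hL0)
    have h := ENNReal.toReal_mono (ENNReal.natCast_ne_top m) hbad
    rw [ENNReal.toReal_mul, ENNReal.toReal_natCast, ENNReal.toReal_natCast, Fintype.card_fin,
      Nat.cast_succ] at h
    linarith
  rw [hgood, prob_compl_eq_one_sub hBm, ENNReal.ofReal_sub _ hδ0.le, ENNReal.ofReal_one]
  exact tsub_le_tsub_left hPB 1
end
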